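/- arXiv:2203.17207 — 4 statements merged into one kernel-verified Lean document; each statement's English description precedes it below -/
import Mathlib

section
/- There is a universal constant K > 0 with the following property. Let X be a finite set and let F ⊆ 2^X be an increasing family with F ≠ ∅ and F ≠ 2^X whose largest minimal element has size ℓ(F) ≥ 2. Then for every p ∈ [0,1] with p ≥ K · q(F) · log₂ ℓ(F), one has μ_p(F) > 1/2. (Equivalently, the threshold satisfies p_c(F) ≤ K q(F) log₂ ℓ(F).) -/
open Finset

/-- `μ_p(F)`: the product measure of the family `F`, i.e.
`∑_{A ∈ F} p^{|A|} (1-p)^{|X ∖ A|}`. -/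
def mu {α : Type*} [Fintype α] (p : ℝ) (F : Finset (Finset α)) : ℝ :=
  ∑ A ∈ F, p ^ A.card * (1 - p) ^ (Fintype.card α - A.card)

/-- `F` is `p`-small: there is a cover `G` of `F` with `∑_{S ∈ G} p^{|S|} ≤ 1/2`. -/
def PSmall {α : Type*} (p : ℝ) (F : Finset (Finset α)) : Prop :=
  ∃ G : Finset (Finset α), (∀ A ∈ F, ∃ S ∈ G, S ⊆ A) ∧ ∑ S ∈ G, p ^ S.card ≤ 1 / 2

/-- `q(F)`: the expectation threshold, the maximum `p ∈ [0,1]` such that `F` is `p`-small. -/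
noncomputable def qF {α : Type*} (F : Finset (Finset α)) : ℝ :=
  sSup {q : ℝ | 0 ≤ q ∧ q ≤ 1 ∧ PSmall q F}

/-- `ℓ(F)`: the size of a largest minimal element of `F`. -/
noncomputable def ellF {α : Type*} (F : Finset (Finset α)) : ℕ :=
  sSup {n : ℕ | ∃ A ∈ F, (∀ B ∈ F, B ⊆ A → B = A) ∧ A.card = n}

theorem bddAbove_pSmall {α : Type*} (F : Finset (Finset α)) :
    BddAbove {q : ℝ | 0 ≤ q ∧ q ≤ 1 ∧ PSmall q F} :=
  ⟨1, fun _ hq => hq.2.1⟩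

theorem card_le_ellF {α : Type*} [Fintype α] {F : Finset (Finset α)} {A : Finset α} (hA : A ∈ F)
    (hmin : ∀ B ∈ F, B ⊆ A → B = A) : A.card ≤ ellF F :=
  le_csSup ⟨Fintype.card α, by rintro n ⟨B, -, -, rfl⟩; exact card_le_univ B⟩ ⟨A, hA, hmin, rfl⟩

/-- The weight of `A` under the product measure of density `p`. -/
def weight {α : Type*} [Fintype α] (p : ℝ) (A : Finset α) : ℝ :=
  p ^ A.card * (1 - p) ^ (Fintype.card α - A.card)

/-- The probability that a random set of density `p` contains no member of `H`. -/
noncomputable def failProb {α : Type*} [Fintype α] [DecidableEq α] (p : ℝ)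
    (H : Finset (Finset α)) : ℝ :=
  ∑ Z : Finset α, weight p Z * if ∃ S ∈ H, S ⊆ Z then 0 else 1

/-- The inclusion-minimal members of `{S \ W : S ∈ H}`. -/
def minFragments {α : Type*} [DecidableEq α] (H : Finset (Finset α)) (W : Finset α) :
    Finset (Finset α) :=
  (H.image (· \ W)).filter fun T => ∀ S ∈ H, S \ W ⊆ T → S \ W = T

section

variable {α : Type*} [DecidableEq α]

theorem exists_eq_sdiff_of_mem_minFragments {H : Finset (Finset α)} {W T : Finset α}
    (hT : T ∈ minFragments H W) : ∃ S ∈ H, S \ W = T :=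
  mem_image.1 (mem_filter.1 hT).1

theorem sdiff_eq_of_mem_minFragments {H : Finset (Finset α)} {W T S : Finset α}
    (hT : T ∈ minFragments H W) (hS : S ∈ H) (h : S \ W ⊆ T) : S \ W = T :=
  (mem_filter.1 hT).2 S hS h

theorem disjoint_of_mem_minFragments {H : Finset (Finset α)} {W T : Finset α}
    (hT : T ∈ minFragments H W) : Disjoint W T := by
  obtain ⟨S, -, rfl⟩ := exists_eq_sdiff_of_mem_minFragments hT
  exact disjoint_sdiff

theorem exists_minFragments_subset (H : Finset (Finset α)) (W : Finset α) {S : Finset α}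
    (hS : S ∈ H) : ∃ T ∈ minFragments H W, T ⊆ S \ W := by
  have hmem : S \ W ∈ H.image (· \ W) := mem_image_of_mem _ hS
  obtain ⟨T, hTS, hT⟩ := (H.image (· \ W)).exists_le_minimal hmem
  refine ⟨T, mem_filter.2 ⟨hT.prop, fun S' hS' h => ?_⟩, hTS⟩
  exact hT.eq_of_le (mem_image_of_mem _ hS') h

end

section

variable {α : Type*} [Fintype α]

theorem weight_nonneg {p : ℝ} (h0 : 0 ≤ p) (h1 : p ≤ 1) (A : Finset α) : 0 ≤ weight p A :=
  mul_nonneg (pow_nonneg h0 _) (pow_nonneg (by linarith) _)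

theorem sum_weight (p : ℝ) : ∑ A : Finset α, weight p A = 1 := by
  have h := Finset.sum_pow_mul_eq_add_pow p (1 - p) (univ : Finset α)
  simpa [weight] using h

variable [DecidableEq α]

theorem weight_mul_pow_le {w : ℝ} (h0 : 0 ≤ w) (h1 : w ≤ 1) {W T : Finset α}
    (h : Disjoint W T) : weight w W * w ^ T.card ≤ weight w (W ∪ T) := by
  unfold weight
  rw [card_union_of_disjoint h, pow_add]
  have h2 : (1 - w) ^ (Fintype.card α - W.card) ≤
      (1 - w) ^ (Fintype.card α - (W.card + T.card)) :=
    pow_le_pow_of_le_one (by linarith) (by linarith) (by omega)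
  calc _ = w ^ W.card * w ^ T.card * (1 - w) ^ (Fintype.card α - W.card) := by ring
    _ ≤ _ := mul_le_mul_of_nonneg_left h2 (by positivity)

theorem sum_weight_union_eq (v : ℝ) {A C : Finset α} (h : A ⊆ C) :
    ∑ B : Finset α, (if A ∪ B = C then weight v B else 0) =
      v ^ (C.card - A.card) * (1 - v) ^ (Fintype.card α - C.card) := by
  rw [← Finset.sum_filter]
  have hA := Finset.sum_pow_mul_eq_add_pow v (1 - v) A
  rw [add_sub_cancel, one_pow] at hA
  refine Eq.symm (Eq.trans ((congrArg _ hA).trans (mul_one _) |>.symm) ?_)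
  rw [mul_sum]
  refine Finset.sum_bij' (fun D _ => (C \ A) ∪ D) (fun B _ => B ∩ A) ?_ ?_ ?_ ?_ ?_
  · intro D hD
    rw [mem_powerset] at hD
    simp only [mem_filter, mem_univ, true_and]
    grind
  · intro B _
    simp
  · intro D hD
    rw [mem_powerset] at hD
    grind
  · intro B hB
    simp only [mem_filter, mem_univ, true_and] at hB
    grind
  · intro D hD
    rw [mem_powerset] at hD
    have hdis : Disjoint (C \ A) D := by
      rw [Finset.disjoint_left]; grind
    have hc := card_union_of_disjoint hdis
    rw [card_sdiff_of_subset h] at hc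
    have h1 := card_le_card h
    have h2 := card_le_card hD
    have h3 := card_le_univ C
    unfold weight
    rw [hc, pow_add,
      show Fintype.card α - (C.card - A.card + D.card) =
        (Fintype.card α - C.card) + (A.card - D.card) by omega, pow_add]
    ring

theorem sum_weight_mul_weight (w v : ℝ) (C : Finset α) :
    ∑ A : Finset α, ∑ B : Finset α, (if A ∪ B = C then weight w A * weight v B else 0) =
      weight (w + (1 - w) * v) C := by
  have hC := Finset.sum_pow_mul_eq_add_pow w ((1 - w) * v) C
  have h1 : ∀ A : Finset α,
      ∑ B : Finset α, (if A ∪ B = C then weight w A * weight v B else 0) =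
        if A ∈ C.powerset then w ^ A.card * ((1 - w) * v) ^ (C.card - A.card) *
          ((1 - w) * (1 - v)) ^ (Fintype.card α - C.card) else 0 := by
    intro A
    split_ifs with hA
    · rw [mem_powerset] at hA
      have h2 := sum_weight_union_eq v hA
      have h3 := card_le_card hA
      have h4 := card_le_univ C
      simp only [← mul_ite_zero, ← mul_sum]
      rw [h2, weight, show Fintype.card α - A.card =
        (Fintype.card α - C.card) + (C.card - A.card) by omega, pow_add, mul_pow, mul_pow]
      ring
    · refine sum_eq_zero fun B _ => if_neg ?_
      rintro rfl
      exact hA (mem_powerset.2 subset_union_left)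
  rw [sum_congr rfl fun A _ => h1 A, sum_ite_mem, univ_inter, ← sum_mul, hC, weight]
  congr 2
  ring

/-- The union of independent random sets of densities `w` and `v` is a random set of density
`w + (1 - w) v`. -/
theorem sum_weight_union (w v : ℝ) (f : Finset α → ℝ) :
    ∑ C : Finset α, weight (w + (1 - w) * v) C * f C =
      ∑ A : Finset α, weight w A * ∑ B : Finset α, weight v B * f (A ∪ B) := by
  simp only [← sum_weight_mul_weight, sum_mul, mul_sum]
  rw [sum_comm]
  refine sum_congr rfl fun A _ => ?_
  rw [sum_comm]
  refine sum_congr rfl fun B _ => ?_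
  simp [ite_mul, mul_assoc]

theorem failProb_nonneg {p : ℝ} (h0 : 0 ≤ p) (h1 : p ≤ 1) (H : Finset (Finset α)) :
    0 ≤ failProb p H :=
  sum_nonneg fun Z _ => mul_nonneg (weight_nonneg h0 h1 Z) (by split_ifs <;> norm_num)

theorem failProb_le_one {p : ℝ} (h0 : 0 ≤ p) (h1 : p ≤ 1) (H : Finset (Finset α)) :
    failProb p H ≤ 1 := by
  rw [← sum_weight (α := α) p]
  exact sum_le_sum fun Z _ =>
    mul_le_of_le_one_right (weight_nonneg h0 h1 Z) (by split_ifs <;> norm_num)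

theorem mu_add_failProb (p : ℝ) {F H : Finset (Finset α)}
    (h : ∀ Z, Z ∈ F ↔ ∃ S ∈ H, S ⊆ Z) : mu p F + failProb p H = 1 := by
  have h1 : mu p F = ∑ Z : Finset α, if Z ∈ F then weight p Z else 0 := by
    rw [sum_ite_mem, univ_inter]
    rfl
  rw [h1, failProb, ← sum_add_distrib]
  refine Eq.trans ?_ (sum_weight (α := α) p)
  refine sum_congr rfl fun Z _ => ?_
  simp only [← h]
  split_ifs <;> simp


/-- The expected cost of the large minimal fragments is small. -/
theorem sum_weight_mul_cost_le {w : ℝ} (h0 : 0 ≤ w) (h1 : w ≤ 1) {l : ℕ}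
    {H : Finset (Finset α)} (hH : ∀ S ∈ H, S.card ≤ l) :
    ∑ W : Finset α, weight w W *
      ∑ T ∈ (minFragments H W).filter (fun T => l < 2 * T.card), (w / 256) ^ T.card ≤
      (1 / 8) ^ l := by
  have hex : ∀ Z : Finset α, ∃ Y : Finset α, Y.card ≤ l ∧
      ((∃ S ∈ H, S ⊆ Z) → Y ∈ H ∧ Y ⊆ Z) := by
    intro Z
    by_cases h : ∃ S ∈ H, S ⊆ Z
    · obtain ⟨S, hS, hSZ⟩ := h
      exact ⟨S, hH S hS, fun _ => ⟨hS, hSZ⟩⟩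
    · exact ⟨∅, by simp, fun h' => absurd h' h⟩
  choose φ hφl hφ using hex
  set U : Finset α → Finset (Finset α) :=
    fun W => (minFragments H W).filter (fun T => l < 2 * T.card)
  have hsub : ∀ W T, T ∈ U W → T ⊆ φ (W ∪ T) := by
    intro W T hT
    have hT' := (mem_filter.1 hT).1
    obtain ⟨S, hS, hST⟩ := exists_eq_sdiff_of_mem_minFragments hT'
    have h2 := hφ (W ∪ T) ⟨S, hS, by rw [← hST]; simp⟩
    have h3 := sdiff_eq_of_mem_minFragments hT' h2.1 (by
      intro x hx
      have := h2.2 (mem_sdiff.1 hx).1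
      have := (mem_sdiff.1 hx).2
      grind)
    rw [← h3]
    nth_rewrite 2 [h3]
    exact sdiff_subset
  have hterm : ∀ W T, T ∈ U W →
      weight w W * (w / 256) ^ T.card ≤ (1 / 16) ^ l * weight w (W ∪ T) := by
    intro W T hT
    have hd := weight_mul_pow_le h0 h1 (disjoint_of_mem_minFragments (mem_filter.1 hT).1)
    have hl := (mem_filter.1 hT).2
    have h2 : ((1 : ℝ) / 256) ^ T.card ≤ (1 / 16) ^ l := by
      rw [show (1 : ℝ) / 256 = (1 / 16) ^ 2 by norm_num, ← pow_mul]
      exact pow_le_pow_of_le_one (by norm_num) (by norm_num) hl.le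
    calc weight w W * (w / 256) ^ T.card
        = (1 / 256) ^ T.card * (weight w W * w ^ T.card) := by
          rw [div_eq_mul_one_div, mul_pow]; ring
      _ ≤ _ := mul_le_mul h2 hd
          (mul_nonneg (weight_nonneg h0 h1 W) (pow_nonneg h0 _)) (by positivity)
  have hfix : ∀ T : Finset α, ∑ W : Finset α, (if T ∈ U W then weight w (W ∪ T) else 0) ≤
      ∑ Z : Finset α, if T ⊆ φ Z then weight w Z else 0 := by
    intro T
    rw [← sum_filter, ← sum_filter]
    rw [← sum_image (g := fun W => W ∪ T) (f := fun Z => weight w Z)]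
    · refine sum_le_sum_of_subset_of_nonneg ?_ fun Z _ _ => weight_nonneg h0 h1 Z
      intro Z hZ
      obtain ⟨W, hW, rfl⟩ := mem_image.1 hZ
      exact mem_filter.2 ⟨mem_univ _, hsub W T (mem_filter.1 hW).2⟩
    · intro W hW W' hW' h
      have hd := disjoint_of_mem_minFragments
        (mem_filter.1 (mem_filter.1 (mem_coe.1 hW)).2).1
      have hd' := disjoint_of_mem_minFragments
        (mem_filter.1 (mem_filter.1 (mem_coe.1 hW')).2).1
      have h2 := congrArg (· \ T) h
      simpa [union_sdiff_cancel_right hd, union_sdiff_cancel_right hd'] using h2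
  calc ∑ W : Finset α, weight w W * ∑ T ∈ U W, (w / 256) ^ T.card
      ≤ ∑ W : Finset α, ∑ T : Finset α,
          (1 / 16) ^ l * (if T ∈ U W then weight w (W ∪ T) else 0) := by
        refine sum_le_sum fun W _ => ?_
        simp only [mul_ite, mul_zero]
        rw [mul_sum, sum_ite_mem, univ_inter]
        exact sum_le_sum fun T hT => hterm W T hT
    _ = (1 / 16) ^ l * ∑ T : Finset α, ∑ W : Finset α,
          (if T ∈ U W then weight w (W ∪ T) else 0) := by
        rw [sum_comm]; simp only [mul_sum]
    _ ≤ (1 / 16) ^ l * ∑ T : Finset α, ∑ Z : Finset α, (if T ⊆ φ Z then weight w Z else 0) :=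
        mul_le_mul_of_nonneg_left (sum_le_sum fun T _ => hfix T) (by positivity)
    _ = (1 / 16) ^ l * ∑ Z : Finset α, weight w Z * 2 ^ (φ Z).card := by
        rw [sum_comm]
        congr 1
        refine sum_congr rfl fun Z _ => ?_
        simp only [← mem_powerset]
        rw [sum_ite_mem, univ_inter, sum_const, card_powerset, nsmul_eq_mul]
        push_cast
        ring
    _ ≤ (1 / 16) ^ l * ∑ Z : Finset α, weight w Z * 2 ^ l := by
        gcongr with Z
        · exact weight_nonneg h0 h1 Z
        · norm_num
        · exact hφl Z
    _ = (1 / 8) ^ l := by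
        rw [← sum_mul, sum_weight, one_mul, ← mul_pow]
        norm_num

theorem mul_failProb_eq_zero {p c q : ℝ} (hc : 0 ≤ c) {H : Finset (Finset α)}
    (hH : ∀ S ∈ H, S.card ≤ 0)
    (hcov : ∀ G : Finset (Finset α), (∀ A ∈ H, ∃ S ∈ G, S ⊆ A) → c ≤ ∑ S ∈ G, q ^ S.card) :
    c * failProb p H = 0 := by
  rcases H.eq_empty_or_nonempty with rfl | ⟨S, hS⟩
  · have := hcov ∅ (by simp)
    rw [sum_empty] at this
    rw [le_antisymm this hc, zero_mul]
  · have hS0 : S = ∅ := card_eq_zero.1 (Nat.le_zero.1 (hH S hS))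
    subst hS0
    have h : ∀ Z : Finset α, ∃ S ∈ H, S ⊆ Z := fun Z => ⟨∅, hS, empty_subset Z⟩
    simp [failProb, h]

theorem failProb_union_le {w v : ℝ} (h0 : 0 ≤ w) (h1 : w ≤ 1) (hv0 : 0 ≤ v) (hv1 : v ≤ 1)
    (H : Finset (Finset α)) (H' : Finset α → Finset (Finset α))
    (h : ∀ W, H' W ⊆ minFragments H W) :
    failProb (w + (1 - w) * v) H ≤ ∑ W : Finset α, weight w W * failProb v (H' W) := by
  rw [failProb, sum_weight_union]
  refine sum_le_sum fun W _ => mul_le_mul_of_nonneg_left ?_ (weight_nonneg h0 h1 W)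
  refine sum_le_sum fun B _ => mul_le_mul_of_nonneg_left ?_ (weight_nonneg hv0 hv1 B)
  split_ifs with h2 h3 h3 <;> try norm_num
  obtain ⟨T, hT, hTB⟩ := h3
  obtain ⟨S, hS, rfl⟩ := exists_eq_sdiff_of_mem_minFragments (h W hT)
  exact h2 ⟨S, hS, sdiff_le_iff.1 hTB⟩

/-- If every cover of an `l`-bounded family `H` costs at least `c` at density `w / 256`, then a
random set of density at least `k w`, where `l < 2 ^ k`, misses `H` with small probability. -/
theorem mul_failProb_le {w : ℝ} (h0 : 0 ≤ w) (h1 : w ≤ 1 / 2) (k : ℕ) :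
    ∀ (l : ℕ), l < 2 ^ k → ∀ H : Finset (Finset α), (∀ S ∈ H, S.card ≤ l) →
    ∀ c : ℝ, 0 ≤ c →
    (∀ G : Finset (Finset α), (∀ A ∈ H, ∃ S ∈ G, S ⊆ A) → c ≤ ∑ S ∈ G, (w / 256) ^ S.card) →
    ∀ p : ℝ, k * w ≤ p → p ≤ 1 → c * failProb p H ≤ (1 - (1 / 8) ^ l) / 7 := by
  induction k with
  | zero =>
    intro l hl H hH c hc hcov p _ _
    obtain rfl : l = 0 := by simpa using hl
    rw [mul_failProb_eq_zero hc hH hcov]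
    norm_num
  | succ k ih =>
    intro l hl H hH c hc hcov p hp hp1
    rcases Nat.eq_zero_or_pos l with rfl | hlpos
    · rw [mul_failProb_eq_zero hc hH hcov]
      norm_num
    obtain ⟨v, hv⟩ : ∃ v, v = (p - w) / (1 - w) := ⟨_, rfl⟩
    have hw : 0 < 1 - w := by linarith
    have hpv : p = w + (1 - w) * v := by rw [hv]; field_simp; ring
    push_cast at hp
    have hkw : 0 ≤ k * w := by positivity
    have hvk : k * w ≤ v := by
      rw [hv, le_div_iff₀ hw]
      nlinarith
    have hv1 : v ≤ 1 := by
      rw [hv, div_le_one hw]; linarith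
    have hv0 : 0 ≤ v := hkw.trans hvk
    set U : Finset α → Finset (Finset α) :=
      fun W => (minFragments H W).filter (fun T => l < 2 * T.card)
    set H' : Finset α → Finset (Finset α) :=
      fun W => (minFragments H W).filter (fun T => ¬ l < 2 * T.card)
    set cost : Finset (Finset α) → ℝ := fun G => ∑ S ∈ G, (w / 256) ^ S.card with hcost
    have hcost0 : ∀ G, 0 ≤ cost G := fun G => sum_nonneg fun S _ => by positivity
    have hpt : ∀ W, c * failProb v (H' W) ≤ cost (U W) + (1 - (1 / 8) ^ (l / 2)) / 7 := by
      intro W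
      have h2 := ih (l / 2) (by rw [pow_succ] at hl; omega) (H' W)
        (fun S hS => by have := (mem_filter.1 hS).2; omega)
        (max 0 (c - cost (U W))) (le_max_left _ _) (by
          intro G hG
          refine max_le (hcost0 G) ?_
          have h3 := hcov (U W ∪ G) (by
            intro S hS
            obtain ⟨T, hT, hTS⟩ := exists_minFragments_subset H W hS
            by_cases hlT : l < 2 * T.card
            · exact ⟨T, mem_union_left _ (mem_filter.2 ⟨hT, hlT⟩), hTS.trans sdiff_subset⟩
            · obtain ⟨R, hR, hRT⟩ := hG T (mem_filter.2 ⟨hT, hlT⟩)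
              exact ⟨R, mem_union_right _ hR, hRT.trans (hTS.trans sdiff_subset)⟩)
          have h4 : cost (U W ∪ G) ≤ cost (U W) + cost G := by
            have h5 := sum_union_inter (s₁ := U W) (s₂ := G) (f := fun S => (w / 256) ^ S.card)
            have h6 := hcost0 (U W ∩ G)
            simp only [hcost] at h6 ⊢
            linarith
          simp only [hcost] at h4 ⊢
          linarith) v hvk hv1
      have hf0 := failProb_nonneg hv0 hv1 (H' W)
      have hf1 := failProb_le_one hv0 hv1 (H' W)
      have h3 := mul_le_mul_of_nonneg_right (le_max_right 0 (c - cost (U W))) hf0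
      have h4 := mul_le_mul_of_nonneg_left hf1 (hcost0 (U W))
      linarith
    have hw1 : w ≤ 1 := by linarith
    have hpow : ((1 : ℝ) / 8) ^ l * 8 ≤ (1 / 8) ^ (l / 2) := by
      obtain ⟨m, rfl⟩ : ∃ m, l = m + 1 := ⟨l - 1, by omega⟩
      calc ((1 : ℝ) / 8) ^ (m + 1) * 8 = (1 / 8) ^ m := by ring
        _ ≤ _ := pow_le_pow_of_le_one (by norm_num) (by norm_num) (by omega)
    calc c * failProb p H
        ≤ c * ∑ W : Finset α, weight w W * failProb v (H' W) := by
          rw [hpv]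
          exact mul_le_mul_of_nonneg_left
            (failProb_union_le h0 hw1 hv0 hv1 H H' fun W => filter_subset _ _) hc
      _ = ∑ W : Finset α, weight w W * (c * failProb v (H' W)) := by
          rw [mul_sum]; exact sum_congr rfl fun W _ => by ring
      _ ≤ ∑ W : Finset α, weight w W * (cost (U W) + (1 - (1 / 8) ^ (l / 2)) / 7) :=
          sum_le_sum fun W _ => mul_le_mul_of_nonneg_left (hpt W) (weight_nonneg h0 hw1 W)
      _ = ∑ W : Finset α, weight w W * cost (U W) + (1 - (1 / 8) ^ (l / 2)) / 7 := by
          simp only [mul_add, sum_add_distrib]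
          rw [← sum_mul, sum_weight, one_mul]
      _ ≤ (1 / 8) ^ l + (1 - (1 / 8) ^ (l / 2)) / 7 :=
          add_le_add_left (sum_weight_mul_cost_le h0 hw1 hH) _
      _ ≤ _ := by linarith

theorem qF_pos {F : Finset (Finset α)} (hne : F.Nonempty) (h : ∅ ∉ F) : 0 < qF F := by
  have hmem : ∀ A ∈ F, ∃ x, x ∈ A := fun A hA =>
    nonempty_iff_ne_empty.2 fun hA0 => h (hA0 ▸ hA)
  obtain ⟨A, hA⟩ := hne
  obtain ⟨x, -⟩ := hmem A hA
  have hn : (1 : ℝ) ≤ Fintype.card α := by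
    exact_mod_cast Fintype.card_pos_iff.2 ⟨x⟩
  have hq : (0 : ℝ) < 1 / (2 * Fintype.card α) := by positivity
  refine hq.trans_le (le_csSup (bddAbove_pSmall F) ⟨hq.le, ?_, ?_⟩)
  · rw [div_le_one (by positivity)]; linarith
  · refine ⟨univ.image fun x : α => {x}, fun B hB => ?_, ?_⟩
    · obtain ⟨y, hy⟩ := hmem B hB
      exact ⟨{y}, mem_image_of_mem _ (mem_univ y), singleton_subset_iff.2 hy⟩
    · rw [sum_image fun a _ b _ hab => singleton_injective hab]
      simp only [card_singleton, pow_one, sum_const, card_univ, nsmul_eq_mul]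
      apply le_of_eq
      field_simp

end

/-- The Kahn–Kalai conjecture: `p_c(F) ≤ K q(F) log₂ ℓ(F)`, stated as: for any
`p ∈ [0,1]` with `p ≥ K q(F) log₂ ℓ(F)` one has `μ_p(F) > 1/2`. -/
theorem kahn_kalai :
    ∃ K : ℝ, 0 < K ∧
      ∀ (α : Type) [Fintype α] [DecidableEq α] (F : Finset (Finset α)),
        (∀ A ∈ F, ∀ B : Finset α, A ⊆ B → B ∈ F) →
        F.Nonempty → F ≠ (Finset.univ : Finset α).powerset → 2 ≤ ellF F →
        ∀ p : ℝ, 0 ≤ p → p ≤ 1 → K * qF F * Real.logb 2 (ellF F) ≤ p →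
          1 / 2 < mu p F := by
  refine ⟨1024, by norm_num, ?_⟩
  intro α _ _ F hinc hne hproper hl p _ hp1 hp
  have hempty : ∅ ∉ F := fun h => hproper (by
    ext A
    simpa using hinc ∅ h A (empty_subset A))
  have hq := qF_pos hne hempty
  set k := Nat.log 2 (ellF F)
  have hk1 : 1 ≤ k := Nat.log_pos (by norm_num) hl
  have hklog : (k : ℝ) ≤ Real.logb 2 (ellF F) := by
    exact_mod_cast Real.natLog_le_logb (ellF F) 2
  have hk1' : (1 : ℝ) ≤ k := by exact_mod_cast hk1
  have hkw : ((k + 1 : ℕ) : ℝ) * (512 * qF F) ≤ p := by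
    push_cast
    nlinarith
  have hw : 512 * qF F ≤ 1 / 2 := by
    push_cast at hkw
    nlinarith
  set H := F.filter fun A => ∀ B ∈ F, B ⊆ A → B = A
  have hmin : ∀ A ∈ F, ∃ S ∈ H, S ⊆ A := by
    intro A hA
    obtain ⟨S, hSA, hS⟩ := F.exists_le_minimal hA
    exact ⟨S, mem_filter.2 ⟨hS.prop, fun B hB h => hS.eq_of_le hB h⟩, hSA⟩
  have hnot : ¬ PSmall (2 * qF F) F := fun h => by
    have := le_csSup (bddAbove_pSmall F) ⟨by linarith, by linarith, h⟩
    change 2 * qF F ≤ qF F at this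
    linarith
  have hmain := mul_failProb_le (by positivity) hw (k + 1) (ellF F)
    (Nat.lt_pow_succ_log_self (by norm_num) _) H
    (fun S hS => card_le_ellF (mem_filter.1 hS).1 (mem_filter.1 hS).2) (1 / 2) (by norm_num)
    (by
      intro G hG
      by_contra! hlt
      refine hnot ⟨G, fun A hA => ?_, ?_⟩
      · obtain ⟨S, hS, hSA⟩ := hmin A hA
        obtain ⟨T, hT, hTS⟩ := hG S hS
        exact ⟨T, hT, hTS.trans hSA⟩
      · rw [show 512 * qF F / 256 = 2 * qF F by ring] at hlt
        exact hlt.le) p hkw hp1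
  have hsum := mu_add_failProb p (F := F) (H := H) fun Z =>
    ⟨hmin Z, fun ⟨S, hS, hSZ⟩ => hinc S (mem_filter.1 hS).1 Z hSZ⟩
  have hpos : (0 : ℝ) < (1 / 8) ^ ellF F := by positivity
  linarith
end

section
/- Let X be a finite set with |X| = n, let F ⊆ 2^X be an increasing family, let p ∈ [0,1], and let 0 ≤ m ≤ n be an integer. Then μ_p(F) ≥ P(Bin(n,p) ≥ m) · P(X_m ∈ F); explicitly, Σ_{A∈F} p^{|A|}(1−p)^{n−|A|} ≥ (Σ_{k=m}^{n} C(n,k) p^k (1−p)^{n−k}) · |F ∩ {A ⊆ X : |A| = m}| / C(n,m). -/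
open Finset

/-- Double counting the inclusions between layers `m` and `k` of an increasing family. -/
theorem card_layer_mul_choose_le {α : Type*} [Fintype α] [DecidableEq α]
    (F : Finset (Finset α)) (hincr : ∀ A ∈ F, ∀ B : Finset α, A ⊆ B → B ∈ F)
    {m k : ℕ} (hmk : m ≤ k) :
    #{A ∈ F | #A = m} * (Fintype.card α - m).choose (k - m) ≤
      #{A ∈ F | #A = k} * k.choose m := by
  refine card_mul_le_card_mul (· ⊆ ·) (fun A hA => ?_) (fun B hB => ?_)
  · obtain ⟨hAF, rfl⟩ := mem_filter.1 hA
    rw [← card_compl, ← card_powersetCard]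
    refine card_le_card_of_injOn (A ∪ ·) (fun C hC => ?_) (fun C hC D hD h => ?_)
    · obtain ⟨hCA, hC⟩ := mem_powersetCard.1 hC
      have hdisj : Disjoint A C := (disjoint_compl_right (a := A)).mono_right hCA
      simp only [coe_bipartiteAbove, Set.mem_ofPred_eq, mem_filter]
      refine ⟨⟨hincr A hAF _ subset_union_left, ?_⟩, subset_union_left⟩
      rw [card_union_of_disjoint hdisj, hC]
      omega
    · have hC' := (mem_powersetCard.1 hC).1
      have hD' := (mem_powersetCard.1 hD).1
      ext x
      have hx : x ∈ A ∪ C ↔ x ∈ A ∪ D := by rw [show A ∪ C = A ∪ D from h]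
      have hxC := @hC' x
      have hxD := @hD' x
      simp only [mem_union, mem_compl] at hx hxC hxD
      tauto
  · obtain ⟨-, rfl⟩ := mem_filter.1 hB
    rw [← card_powersetCard]
    refine card_le_card fun A hA => ?_
    obtain ⟨hA, hAB⟩ := mem_filter.1 hA
    exact mem_powersetCard.2 ⟨hAB, (mem_filter.1 hA).2⟩

/-- The density of an increasing family within a layer grows with the layer. -/
theorem choose_mul_layer_density_le {α : Type*} [Fintype α] [DecidableEq α]
    (F : Finset (Finset α)) (hincr : ∀ A ∈ F, ∀ B : Finset α, A ⊆ B → B ∈ F)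
    {m k : ℕ} (hmk : m ≤ k) (hk : k ≤ Fintype.card α) :
    ((Fintype.card α).choose k : ℝ) *
        ((#{A ∈ F | #A = m} : ℝ) / ((Fintype.card α).choose m : ℝ)) ≤ #{A ∈ F | #A = k} := by
  have hm0 : (0 : ℝ) < (Fintype.card α).choose m :=
    mod_cast Nat.choose_pos (hmk.trans hk)
  rw [← mul_div_assoc, div_le_iff₀ hm0]
  norm_cast
  refine Nat.le_of_mul_le_mul_right ?_ (Nat.choose_pos hmk)
  calc (Fintype.card α).choose k * #{A ∈ F | #A = m} * k.choose m
      = (Fintype.card α).choose m *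
          (#{A ∈ F | #A = m} * (Fintype.card α - m).choose (k - m)) := by
        rw [mul_right_comm, Nat.choose_mul hmk]
        ring
    _ ≤ (Fintype.card α).choose m * (#{A ∈ F | #A = k} * k.choose m) :=
        Nat.mul_le_mul_left _ (card_layer_mul_choose_le F hincr hmk)
    _ = _ := by ring

theorem mu_eq_sum_layers {α : Type*} [Fintype α] (p : ℝ) (F : Finset (Finset α)) :
    mu p F = ∑ k ∈ Iic (Fintype.card α),
      (#{A ∈ F | #A = k} : ℝ) * (p ^ k * (1 - p) ^ (Fintype.card α - k)) := by
  rw [mu, ← sum_fiberwise_of_maps_to (g := card) (t := Iic (Fintype.card α))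
    fun A _ => mem_Iic.2 (card_le_univ A)]
  refine sum_congr rfl fun k _ => ?_
  rw [← nsmul_eq_mul, ← sum_const]
  exact sum_congr rfl fun A hA => by rw [(mem_filter.1 hA).2]

/-- For an increasing family `F`,
`μ_p(F) ≥ P(Bin(n,p) ≥ m) · P(X_m ∈ F)`. -/
theorem mu_ge_binomial_mul_uniform {α : Type*} [Fintype α] [DecidableEq α]
    (F : Finset (Finset α)) (hincr : ∀ A ∈ F, ∀ B : Finset α, A ⊆ B → B ∈ F)
    (p : ℝ) (hp0 : 0 ≤ p) (hp1 : p ≤ 1) (m : ℕ) (hm : m ≤ Fintype.card α) :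
    (∑ k ∈ Finset.Icc m (Fintype.card α),
        ((Fintype.card α).choose k : ℝ) * p ^ k * (1 - p) ^ (Fintype.card α - k)) *
      (((F.filter fun A => A.card = m).card : ℝ) / ((Fintype.card α).choose m : ℝ))
      ≤ mu p F := by
  rw [mu_eq_sum_layers, sum_mul]
  have hp : 0 ≤ 1 - p := sub_nonneg.2 hp1
  calc _ ≤ ∑ k ∈ Icc m (Fintype.card α),
        (#{A ∈ F | #A = k} : ℝ) * (p ^ k * (1 - p) ^ (Fintype.card α - k)) := by
        refine sum_le_sum fun k hk => ?_
        obtain ⟨hmk, hk⟩ := mem_Icc.1 hk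
        rw [mul_assoc ((Fintype.card α).choose k : ℝ), mul_right_comm]
        exact mul_le_mul_of_nonneg_right (choose_mul_layer_density_le F hincr hmk hk)
          (by positivity)
    _ ≤ _ := sum_le_sum_of_subset_of_nonneg Icc_subset_Iic_self fun k _ _ => by positivity
end

section
/- Let H be a hypergraph on a finite set X, let S, Ŝ ∈ H, let W ⊆ X, and let T be a minimum (S,W)-fragment. If Ŝ ⊆ T ∪ W, then T ⊆ Ŝ. -/
open Finset

/-- `T` is an `(S,W)`-fragment (with respect to `H`): `T = S' ∖ W` for some
`S' ∈ H` with `S' ⊆ S ∪ W`. -/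
def IsFragment {α : Type*} [DecidableEq α] (H : Finset (Finset α))
    (S W T : Finset α) : Prop :=
  ∃ S' ∈ H, S' ⊆ S ∪ W ∧ T = S' \ W

/-- `T` is a minimum `(S,W)`-fragment: an `(S,W)`-fragment of minimum size. -/
def IsMinFragment {α : Type*} [DecidableEq α] (H : Finset (Finset α))
    (S W T : Finset α) : Prop :=
  IsFragment H S W T ∧ ∀ T', IsFragment H S W T' → T.card ≤ T'.card

/-- If `T` is a minimum `(S,W)`-fragment and `Ŝ ∈ H` satisfies `Ŝ ⊆ T ∪ W`,
then `T ⊆ Ŝ`. -/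
theorem minFragment_subset {α : Type*} [Fintype α] [DecidableEq α]
    (H : Finset (Finset α)) (S Shat W T : Finset α)
    (hS : S ∈ H) (hShat : Shat ∈ H) (hT : IsMinFragment H S W T)
    (hsub : Shat ⊆ T ∪ W) : T ⊆ Shat := by
  obtain ⟨⟨S', -, hS'sub, rfl⟩, hmin⟩ := hT
  have hfrag : Shat \ W ⊆ S' \ W := by
    intro x hx
    have := hsub (mem_sdiff.1 hx).1
    grind
  have hShat_sub : Shat ⊆ S ∪ W :=
    hsub.trans (union_subset (sdiff_subset.trans hS'sub) subset_union_right)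
  have hcard := hmin (Shat \ W) ⟨Shat, hShat, hShat_sub, rfl⟩
  rw [← eq_of_subset_of_card_le hfrag hcard]
  exact sdiff_subset
end

section
/- Let H be an ℓ-bounded hypergraph on a finite set X with |X| = n, let w and m be nonnegative integers, and for each w-subset W of X fix a function T(·,W) assigning to each S ∈ H a minimum (S,W)-fragment. Then the number of pairs (W, T) such that W is a w-subset of X and T = T(S,W) for some S ∈ H with |T| = m is at most C(n, w+m) · 2^ℓ. -/
open Finset

section FragmentLemmas

variable {α : Type*} [DecidableEq α] {H : Finset (Finset α)} {S W T A : Finset α}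

theorem IsFragment.disjoint (h : IsFragment H S W T) : Disjoint W T := by
  obtain ⟨S', -, -, rfl⟩ := h
  exact disjoint_sdiff

theorem IsFragment.subset (h : IsFragment H S W T) : T ⊆ S := by
  obtain ⟨S', -, hS', rfl⟩ := h
  exact sdiff_le_iff.2 (by rwa [union_comm] at hS')

theorem IsFragment.exists_subset_union (h : IsFragment H S W T) :
    ∃ A ∈ H, A ⊆ W ∪ T := by
  obtain ⟨S', hS'H, -, rfl⟩ := h
  exact ⟨S', hS'H, sdiff_le_iff.1 Subset.rfl⟩

/-- A minimum `(S,W)`-fragment `T` is contained in every edge contained in `W ∪ T`. -/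
theorem IsMinFragment.subset_of_subset_union (h : IsMinFragment H S W T) (hA : A ∈ H)
    (hAWT : A ⊆ W ∪ T) : T ⊆ A := by
  have hfrag : IsFragment H S W (A \ W) := by
    refine ⟨A, hA, hAWT.trans ?_, rfl⟩
    rw [union_comm S W]
    exact union_subset_union_right h.1.subset
  rw [← eq_of_subset_of_card_le (sdiff_le_iff.2 hAWT) (h.2 _ hfrag)]
  exact sdiff_subset

end FragmentLemmas

/-- Counting pairs `(W, T)` with `W` a `w`-subset of `X` and `T = T(S,W)` for some
`S ∈ H` with `|T| = m`: there are at most `C(n, w+m) · 2^ℓ` of them. -/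
theorem fragment_pair_count {α : Type*} [Fintype α] [DecidableEq α]
    (ℓ : ℕ) (H : Finset (Finset α)) (hbd : ∀ S ∈ H, S.card ≤ ℓ)
    (w m : ℕ) (TW : Finset α → Finset α → Finset α)
    (hTW : ∀ W ∈ (Finset.univ : Finset α).powersetCard w,
      ∀ S ∈ H, IsMinFragment H S W (TW W S)) :
    ((((Finset.univ : Finset α).powersetCard w) ×ˢ
          (Finset.univ : Finset α).powerset).filter
        fun P => ∃ S ∈ H, TW P.1 S = P.2 ∧ P.2.card = m).card
      ≤ (Fintype.card α).choose (w + m) * 2 ^ ℓ := by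
  have hedge : ∀ Z : Finset α, ∃ A : Finset α, A.card ≤ ℓ ∧
      ((∃ B ∈ H, B ⊆ Z) → A ∈ H ∧ A ⊆ Z) := by
    intro Z
    by_cases hZ : ∃ B ∈ H, B ⊆ Z
    · obtain ⟨B, hB, hBZ⟩ := hZ
      exact ⟨B, hbd B hB, fun _ => ⟨hB, hBZ⟩⟩
    · exact ⟨∅, by simp, fun h => absurd h hZ⟩
  choose A hAcard hA using hedge
  have hpair : ∀ P ∈ (((Finset.univ : Finset α).powersetCard w) ×ˢ
      (Finset.univ : Finset α).powerset).filter
        fun P => ∃ S ∈ H, TW P.1 S = P.2 ∧ P.2.card = m,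
      P.1.card = w ∧ P.2.card = m ∧ ∃ S, IsMinFragment H S P.1 P.2 := by
    intro P hP
    obtain ⟨hP, S, hS, hT, hm⟩ := mem_filter.1 hP
    have hW := (mem_product.1 hP).1
    exact ⟨(mem_powersetCard.1 hW).2, hm, S, hT ▸ hTW P.1 hW S hS⟩
  calc _ ≤ (((Finset.univ : Finset α).powersetCard (w + m)).sigma
          fun Z => (A Z).powerset).card := by
        refine card_le_card_of_injOn (fun P => ⟨P.1 ∪ P.2, P.2⟩) ?_ ?_
        · intro P hP
          obtain ⟨hw, hm, S, hmin⟩ := hpair P hP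
          obtain ⟨hAH, hAZ⟩ := hA _ hmin.1.exists_subset_union
          exact mem_sigma.2 ⟨mem_powersetCard.2 ⟨subset_univ _, by
            rw [card_union_of_disjoint hmin.1.disjoint, hw, hm]⟩,
            mem_powerset.2 (hmin.subset_of_subset_union hAH hAZ)⟩
        · rintro ⟨W, T⟩ hP ⟨W', T'⟩ hP' heq
          obtain ⟨-, -, S, hmin⟩ := hpair _ hP
          obtain ⟨-, -, S', hmin'⟩ := hpair _ hP'
          simp only [Sigma.mk.injEq, heq_eq_eq] at heq
          obtain ⟨hZ, rfl⟩ := heq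
          have hW : W = W' := by
            calc W = (W ∪ T) \ T := (union_sdiff_cancel_right hmin.1.disjoint).symm
              _ = (W' ∪ T) \ T := by rw [hZ]
              _ = W' := union_sdiff_cancel_right hmin'.1.disjoint
          rw [hW]
    _ ≤ (Fintype.card α).choose (w + m) * 2 ^ ℓ := by
        rw [card_sigma, ← card_univ, ← card_powersetCard, ← smul_eq_mul]
        refine sum_le_card_nsmul _ _ _ fun Z _ => ?_
        rw [card_powerset]
        exact Nat.pow_le_pow_right two_pos (hAcard Z)
end
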